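/- There is a universal constant C > 0 such that the following holds. Fix η ∈ (0,1/2] and an integer k ≥ 1, and let ρ_k(x) = 1 / Σ_{m=0}^k p_m(x)², where p_0, p_1, … are the orthonormal polynomials with respect to P. Then for every x ∈ ℝ with |x| ≤ η k^{−3/2}, one has ρ_k(x) ≥ 1 − Cη. -/

import Mathlib

open MeasureTheory Polynomial

/-- The exponential distribution with rate 1: the probability measure on `[0, ∞)`
with density `e^{-x}`. -/
noncomputable def expDist : Measure ℝ :=
  (volume.restrict (Set.Ici (0 : ℝ))).withDensity fun x => ENNReal.ofReal (Real.exp (-x))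

/-- The distribution `P` placing mass `1 - η` at the point `0` and mass `η` on the
exponential distribution with rate 1. -/
noncomputable def mixP (η : ℝ) : Measure ℝ :=
  ENNReal.ofReal (1 - η) • Measure.dirac (0 : ℝ) + ENNReal.ofReal η • expDist

/-- The Laguerre polynomial `L_m = ∑_{i=0}^m binom(m,i) ((-1)^i / i!) X^i`. -/
noncomputable def laguerreP (m : ℕ) : Polynomial ℝ :=
  ∑ i ∈ Finset.range (m + 1),
    Polynomial.C ((m.choose i : ℝ) * ((-1) ^ i / (Nat.factorial i : ℝ))) * Polynomial.X ^ i

/-- The normalizing constant `μ_m`, with `μ_m^{-2} = η(m + η/(1-η))² + ηm + η²/(1-η)`. -/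
noncomputable def normC (η : ℝ) (m : ℕ) : ℝ :=
  (Real.sqrt (η * ((m : ℝ) + η / (1 - η)) ^ 2 + η * (m : ℝ) + η ^ 2 / (1 - η)))⁻¹

/-- The orthonormal polynomials with respect to `P`: `p_0 ≡ 1` and, for `m ≥ 1`,
`p_m = μ_m ((m + η/(1-η)) L_m - ∑_{ℓ=0}^{m-1} L_ℓ)`. -/
noncomputable def orthP (η : ℝ) : ℕ → Polynomial ℝ
  | 0 => 1
  | m + 1 =>
      Polynomial.C (normC η (m + 1)) *
        (Polynomial.C (((m : ℝ) + 1) + η / (1 - η)) * laguerreP (m + 1) -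
          ∑ ℓ ∈ Finset.range (m + 1), laguerreP ℓ)

/-- `ρ_k(x) = 1 / ∑_{m=0}^k p_m(x)²`. -/
noncomputable def rhoFn (η : ℝ) (k : ℕ) (x : ℝ) : ℝ :=
  1 / ∑ m ∈ Finset.range (k + 1), ((orthP η m).eval x) ^ 2

theorem abs_eval_laguerreP_sub_one_le {m : ℕ} {x : ℝ} (hx : (m : ℝ) * |x| ≤ 1) :
    |(laguerreP m).eval x - 1| ≤ 2 * ((m : ℝ) * |x|) := by
  have heval : (laguerreP m).eval x - 1 =
      ∑ i ∈ Finset.range m, ((m.choose (i + 1) : ℝ) *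
        ((-1) ^ (i + 1) / (Nat.factorial (i + 1) : ℝ))) * x ^ (i + 1) := by
    simp [laguerreP, eval_finsetSum, Finset.sum_range_succ']
  have hpow : (1 + |x|) ^ m - 1 =
      ∑ i ∈ Finset.range m, (m.choose (i + 1) : ℝ) * |x| ^ (i + 1) := by
    rw [add_comm 1 |x|, add_pow, Finset.sum_range_succ']
    simp [mul_comm]
  have hle : |(laguerreP m).eval x - 1| ≤ (1 + |x|) ^ m - 1 := by
    rw [heval, hpow]
    refine (Finset.abs_sum_le_sum_abs _ _).trans (Finset.sum_le_sum fun i _ => ?_)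
    have hfac : (1 : ℝ) ≤ (Nat.factorial (i + 1) : ℝ) := by
      exact_mod_cast Nat.factorial_pos (i + 1)
    rw [abs_mul, abs_mul, abs_div, abs_pow, abs_pow, abs_neg, abs_one, one_pow,
      Nat.abs_cast, Nat.abs_cast]
    refine mul_le_mul_of_nonneg_right ?_ (by positivity)
    refine mul_le_of_le_one_right (by positivity) ?_
    exact div_le_one_of_le₀ hfac (by positivity)
  have hexp : (1 + |x|) ^ m ≤ Real.exp ((m : ℝ) * |x|) := by
    rw [Real.exp_nat_mul]
    gcongr
    linarith [Real.add_one_le_exp |x|]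
  have hnonneg : 0 ≤ (m : ℝ) * |x| := by positivity
  have hbound := Real.abs_exp_sub_one_le (x := (m : ℝ) * |x|) (by rwa [abs_of_nonneg hnonneg])
  rw [abs_of_nonneg hnonneg] at hbound
  linarith [le_abs_self (Real.exp ((m : ℝ) * |x|) - 1)]

theorem abs_laguerreP_combination_le {a x : ℝ} {m : ℕ} (ha : 0 ≤ a) (ha' : a ≤ 1)
    (hx : ((m : ℝ) + 1) * |x| ≤ 1) :
    |((m : ℝ) + 1 + a) * (laguerreP (m + 1)).eval x
        - ∑ ℓ ∈ Finset.range (m + 1), (laguerreP ℓ).eval x|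
      ≤ a + 6 * (((m : ℝ) + 1) ^ 2 * |x|) := by
  have hsplit : ((m : ℝ) + 1 + a) * (laguerreP (m + 1)).eval x
        - ∑ ℓ ∈ Finset.range (m + 1), (laguerreP ℓ).eval x =
      a + ((m : ℝ) + 1 + a) * ((laguerreP (m + 1)).eval x - 1)
        - ∑ ℓ ∈ Finset.range (m + 1), ((laguerreP ℓ).eval x - 1) := by
    simp only [Finset.sum_sub_distrib, Finset.sum_const, Finset.card_range, nsmul_eq_mul]
    push_cast
    ring
  have hlead := abs_eval_laguerreP_sub_one_le (m := m + 1) (x := x) (by push_cast; exact hx)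
  push_cast at hlead
  have hsum : |∑ ℓ ∈ Finset.range (m + 1), ((laguerreP ℓ).eval x - 1)|
      ≤ ((m : ℝ) + 1) * (2 * (((m : ℝ) + 1) * |x|)) := by
    calc _ ≤ ∑ ℓ ∈ Finset.range (m + 1), |(laguerreP ℓ).eval x - 1| :=
          Finset.abs_sum_le_sum_abs _ _
      _ ≤ ∑ _ℓ ∈ Finset.range (m + 1), 2 * (((m : ℝ) + 1) * |x|) := by
          refine Finset.sum_le_sum fun ℓ hℓ => ?_
          have hcast : (ℓ : ℝ) ≤ (m : ℝ) + 1 := by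
            exact_mod_cast (Finset.mem_range.mp hℓ).le
          have hmul : (ℓ : ℝ) * |x| ≤ ((m : ℝ) + 1) * |x| := by gcongr
          exact (abs_eval_laguerreP_sub_one_le (hmul.trans hx)).trans (by linarith)
      _ = _ := by simp
  have hprod : |((m : ℝ) + 1 + a) * ((laguerreP (m + 1)).eval x - 1)|
      ≤ (2 * ((m : ℝ) + 1)) * (2 * (((m : ℝ) + 1) * |x|)) := by
    rw [abs_mul, abs_of_nonneg (by positivity : 0 ≤ (m : ℝ) + 1 + a)]
    gcongr
    linarith [(Nat.cast_nonneg m : (0 : ℝ) ≤ m)]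
  rw [hsplit]
  calc _ ≤ |a| + |((m : ℝ) + 1 + a) * ((laguerreP (m + 1)).eval x - 1)|
        + |∑ ℓ ∈ Finset.range (m + 1), ((laguerreP ℓ).eval x - 1)| :=
        (abs_sub _ _).trans (by gcongr; exact abs_add_le _ _)
    _ ≤ a + (2 * ((m : ℝ) + 1)) * (2 * (((m : ℝ) + 1) * |x|))
        + ((m : ℝ) + 1) * (2 * (((m : ℝ) + 1) * |x|)) := by
        rw [abs_of_nonneg ha]
        gcongr
    _ = _ := by ring

theorem normC_sq_le {η : ℝ} (hη : 0 < η) (hη' : η ≤ 1 / 2) (m : ℕ) :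
    normC η (m + 1) ^ 2 ≤ (η * ((m : ℝ) + 1) ^ 2)⁻¹ := by
  have hpos : 0 < 1 - η := by linarith
  have ha : 0 ≤ η / (1 - η) := by positivity
  have hb : 0 ≤ η ^ 2 / (1 - η) := by positivity
  rw [normC, inv_pow, Real.sq_sqrt (by positivity)]
  push_cast
  gcongr
  have hη_mul : 0 ≤ η * ((m : ℝ) + 1) := by positivity
  have hsq : η * ((m : ℝ) + 1) ^ 2 ≤ η * ((m : ℝ) + 1 + η / (1 - η)) ^ 2 :=
    mul_le_mul_of_nonneg_left
      (pow_le_pow_left₀ (by positivity) (le_add_of_nonneg_right ha) 2) hη.le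
  linarith

theorem eval_orthP_succ_sq_le {η x : ℝ} {m : ℕ} (hη : 0 < η) (hη' : η ≤ 1 / 2)
    (hx : ((m : ℝ) + 1) * |x| ≤ 1) :
    ((orthP η (m + 1)).eval x) ^ 2
      ≤ 8 * η * (1 / ((m : ℝ) + 1) ^ 2) + 72 * (((m : ℝ) + 1) ^ 2 * x ^ 2 / η) := by
  have hpos : 0 < 1 - η := by linarith
  have ha : 0 ≤ η / (1 - η) := by positivity
  have ha_two : η / (1 - η) ≤ 2 * η := by
    rw [div_le_iff₀ hpos]
    nlinarith
  have hcomb := abs_laguerreP_combination_le (m := m) ha (by linarith) hx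
  have heval : (orthP η (m + 1)).eval x = normC η (m + 1) *
      (((m : ℝ) + 1 + η / (1 - η)) * (laguerreP (m + 1)).eval x
        - ∑ ℓ ∈ Finset.range (m + 1), (laguerreP ℓ).eval x) := by
    simp only [orthP, eval_mul, eval_sub, eval_C, eval_finsetSum]
  rw [heval, mul_pow]
  set q := ((m : ℝ) + 1 + η / (1 - η)) * (laguerreP (m + 1)).eval x
        - ∑ ℓ ∈ Finset.range (m + 1), (laguerreP ℓ).eval x
  have hq : q ^ 2 ≤ 2 * (2 * η) ^ 2 + 2 * (6 * (((m : ℝ) + 1) ^ 2 * |x|)) ^ 2 := by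
    have hle : |q| ≤ 2 * η + 6 * (((m : ℝ) + 1) ^ 2 * |x|) := by linarith
    have hsq := pow_le_pow_left₀ (abs_nonneg q) hle 2
    rw [sq_abs] at hsq
    exact hsq.trans (by
      nlinarith [sq_nonneg (2 * η - 6 * (((m : ℝ) + 1) ^ 2 * |x|))])
  calc _ ≤ (η * ((m : ℝ) + 1) ^ 2)⁻¹ *
        (2 * (2 * η) ^ 2 + 2 * (6 * (((m : ℝ) + 1) ^ 2 * |x|)) ^ 2) := by
        gcongr
        exact normC_sq_le hη hη' m
    _ = _ := by
        simp only [mul_pow, sq_abs]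
        field_simp
        ring

theorem sum_range_one_div_succ_sq_le (n : ℕ) :
    ∑ m ∈ Finset.range n, 1 / ((m : ℝ) + 1) ^ 2 ≤ 2 - 1 / (n : ℝ) := by
  induction n with
  | zero => simp
  | succ n ih =>
    rw [Finset.sum_range_succ]
    rcases Nat.eq_zero_or_pos n with rfl | hn
    · norm_num
    · have hn' : (0 : ℝ) < n := by exact_mod_cast hn
      have hstep : 1 / ((n : ℝ) + 1) ^ 2 ≤ 1 / (n : ℝ) - 1 / ((n : ℝ) + 1) := by
        rw [div_sub_div _ _ hn'.ne' (by positivity), div_le_div_iff₀ (by positivity) (by positivity)]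
        nlinarith
      push_cast
      linarith

theorem sum_eval_orthP_sq_le {η x : ℝ} {k : ℕ} (hη : 0 < η) (hη' : η ≤ 1 / 2) (hk : 1 ≤ k)
    (hx : |x| ≤ η * (k : ℝ) ^ (-(3 : ℝ) / 2)) :
    ∑ m ∈ Finset.range (k + 1), ((orthP η m).eval x) ^ 2 ≤ 1 + 88 * η := by
  have hk' : (1 : ℝ) ≤ k := by exact_mod_cast hk
  have hkpos : (0 : ℝ) < k := by linarith
  have hxsq : x ^ 2 * (k : ℝ) ^ 3 ≤ η ^ 2 := by
    have hpow : ((k : ℝ) ^ (-(3 : ℝ) / 2)) ^ 2 * (k : ℝ) ^ 3 = 1 := by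
      rw [← Real.rpow_natCast, ← Real.rpow_natCast, ← Real.rpow_mul hkpos.le,
        ← Real.rpow_add hkpos]
      norm_num
    have hsq := pow_le_pow_left₀ (abs_nonneg x) hx 2
    rw [sq_abs, mul_pow] at hsq
    calc _ ≤ (η ^ 2 * ((k : ℝ) ^ (-(3 : ℝ) / 2)) ^ 2) * (k : ℝ) ^ 3 := by gcongr
      _ = _ := by rw [mul_assoc, hpow, mul_one]
  have hkx : (k : ℝ) * |x| ≤ 1 := by
    have hle : (k : ℝ) ^ (-(3 : ℝ) / 2) ≤ (k : ℝ) ^ (-1 : ℝ) :=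
      Real.rpow_le_rpow_of_exponent_le hk' (by norm_num)
    rw [Real.rpow_neg_one] at hle
    calc (k : ℝ) * |x| ≤ k * (1 * (k : ℝ)⁻¹) := by
          gcongr
          exact hx.trans (by gcongr; linarith)
      _ = 1 := by field_simp
  have hterm : ∀ m ∈ Finset.range k, ((orthP η (m + 1)).eval x) ^ 2 ≤
      8 * η * (1 / ((m : ℝ) + 1) ^ 2) + 72 * η / k := by
    intro m hm
    have hmk : (m : ℝ) + 1 ≤ k := by exact_mod_cast Finset.mem_range.mp hm
    have hmx : ((m : ℝ) + 1) * |x| ≤ 1 := le_trans (by gcongr) hkx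
    refine (eval_orthP_succ_sq_le hη hη' hmx).trans ?_
    have hlast : ((m : ℝ) + 1) ^ 2 * x ^ 2 / η ≤ η / k := by
      rw [div_le_div_iff₀ hη hkpos]
      calc _ ≤ (k : ℝ) ^ 2 * x ^ 2 * k := by gcongr
        _ = x ^ 2 * (k : ℝ) ^ 3 := by ring
        _ ≤ _ := by linarith
    rw [mul_div_assoc 72 η]
    linarith
  have hzero : ((orthP η 0).eval x) ^ 2 = 1 := by simp [orthP]
  have hsum := Finset.sum_le_sum hterm
  rw [Finset.sum_add_distrib, ← Finset.mul_sum, Finset.sum_const, Finset.card_range,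
    nsmul_eq_mul, mul_div_cancel₀ _ hkpos.ne'] at hsum
  have hinv := sum_range_one_div_succ_sq_le k
  have hinv_nonneg : 0 ≤ 1 / (k : ℝ) := by positivity
  have hmul : 8 * η * ∑ m ∈ Finset.range k, 1 / ((m : ℝ) + 1) ^ 2 ≤ 8 * η * 2 := by
    gcongr
    linarith
  rw [Finset.sum_range_succ', hzero]
  linarith

/-- There is a universal constant `C > 0` such that for every `η ∈ (0,1/2]`, every
integer `k ≥ 1` and every `x` with `|x| ≤ η k^{-3/2}`, one has `ρ_k(x) ≥ 1 - Cη`. -/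
theorem rho_lower_bound :
    ∃ C : ℝ, 0 < C ∧
      ∀ (η : ℝ) (k : ℕ) (x : ℝ), 0 < η → η ≤ 1 / 2 → 1 ≤ k →
        |x| ≤ η * (k : ℝ) ^ (-(3 : ℝ) / 2) → 1 - C * η ≤ rhoFn η k x := by
  refine ⟨88, by norm_num, fun η k x hη hη' hk hx => ?_⟩
  have hsum := sum_eval_orthP_sq_le hη hη' hk hx
  have hpos : 0 < ∑ m ∈ Finset.range (k + 1), ((orthP η m).eval x) ^ 2 := by
    rw [Finset.sum_range_succ']
    have hzero : ((orthP η 0).eval x) ^ 2 = 1 := by simp [orthP]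
    rw [hzero]
    positivity
  calc 1 - 88 * η ≤ 1 / (1 + 88 * η) := by
        rw [le_div_iff₀ (by positivity)]
        nlinarith [sq_nonneg η]
    _ ≤ rhoFn η k x := one_div_le_one_div_of_le hpos hsum
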